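/- (Corollary 4.5.) Fix 1 < s < ∞. If a weight w belongs to A_1 ∩ RH_s, then for every 1 < p < ∞ and every q > (p−1)/s + 1 one has w^{1−p} ∈ A_q ∩ RH_∞, and moreover max{[w^{1−p}]_{A_q}, [w^{1−p}]_{RH_∞}} ≤ ([w]_{A_1} · [w]_{RH_s})^{p−1}. -/

import Mathlib

open MeasureTheory

/-- The collection of open balls `B(x, ρ)` (with `ρ > 0`) such that the doubled ball
`B(x, 2ρ)` is contained in `Ω`. -/
def ballsIn {n : ℕ} (Ω : Set (EuclideanSpace ℝ (Fin n))) :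
    Set (Set (EuclideanSpace ℝ (Fin n))) :=
  {B | ∃ x ρ, 0 < ρ ∧ B = Metric.ball x ρ ∧ Metric.ball x (2 * ρ) ⊆ Ω}

/-- A weight on `Ω`: a measurable function that is positive a.e. on `Ω`. -/
def IsWeight {n : ℕ} (Ω : Set (EuclideanSpace ℝ (Fin n)))
    (w : EuclideanSpace ℝ (Fin n) → ℝ) : Prop :=
  Measurable w ∧ ∀ᵐ x ∂volume, x ∈ Ω → 0 < w x

/-- The `p`-mean of `w` over `B`, for an extended-real exponent `p`. -/
noncomputable def pMean {n : ℕ} (w : EuclideanSpace ℝ (Fin n) → ℝ) (p : EReal)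
    (B : Set (EuclideanSpace ℝ (Fin n))) : ℝ :=
  if p = ⊤ then essSup w (volume.restrict B)
  else if p = ⊥ then essInf w (volume.restrict B)
  else if p = 0 then Real.exp (⨍ x in B, Real.log (w x))
  else (⨍ x in B, (w x) ^ p.toReal) ^ (1 / p.toReal)

open Classical in
/-- Finiteness of the `p`-mean of `w` over `B`. -/
def MeanFinite {n : ℕ} (w : EuclideanSpace ℝ (Fin n) → ℝ) (p : EReal)
    (B : Set (EuclideanSpace ℝ (Fin n))) : Prop :=
  if p = ⊤ then ∃ M : ℝ, ∀ᵐ x ∂(volume.restrict B), w x ≤ M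
  else if p = ⊥ then ∃ m : ℝ, ∀ᵐ x ∂(volume.restrict B), m ≤ w x
  else if p = 0 then IntegrableOn (fun x => Real.log (w x)) B
  else IntegrableOn (fun x => (w x) ^ p.toReal) B

/-- `w ∈ RC(r, s, C)` over `Ω`: for every admissible ball the `r`- and `s`-means are finite
and `w(s,B) ≤ C · w(r,B)`. -/
def MemRC {n : ℕ} (Ω : Set (EuclideanSpace ℝ (Fin n)))
    (w : EuclideanSpace ℝ (Fin n) → ℝ) (r s : EReal) (C : ℝ) : Prop :=
  ∀ B ∈ ballsIn Ω, MeanFinite w r B ∧ MeanFinite w s B ∧ pMean w s B ≤ C * pMean w r B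

/-- `w ∈ RC(r,s) = ⋃_{C ≥ 1} RC(r,s,C)`. -/
def InRC {n : ℕ} (Ω : Set (EuclideanSpace ℝ (Fin n)))
    (w : EuclideanSpace ℝ (Fin n) → ℝ) (r s : EReal) : Prop :=
  ∃ C : ℝ, 1 ≤ C ∧ MemRC Ω w r s C

/-- `[w]_{RC(r,s)}`, the least admissible reversal constant. -/
noncomputable def RCconst {n : ℕ} (Ω : Set (EuclideanSpace ℝ (Fin n)))
    (w : EuclideanSpace ℝ (Fin n) → ℝ) (r s : EReal) : ℝ :=
  sInf {C : ℝ | 1 ≤ C ∧ MemRC Ω w r s C}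

theorem core_prob {α : Type*} [MeasurableSpace α] (P : Measure α) [IsProbabilityMeasure P]
    {w : α → ℝ} (hwm : Measurable w) (hpos : ∀ᵐ x ∂P, 0 < w x) {m : ℝ}
    (hm : ∀ᵐ x ∂P, m ≤ w x) {s p t C1 C2 : ℝ} (hs : 1 < s) (hp : 1 < p)
    (ht : 0 < t) (hts : t ≤ s) (hC1 : 1 ≤ C1) (hC2 : 1 ≤ C2)
    (hi : Integrable w P) (his : Integrable (fun x => w x ^ s) P)
    (h1 : ∫ x, w x ∂P ≤ C1 * m) (h2 : (∫ x, w x ^ s ∂P) ^ (1 / s) ≤ C2 * ∫ x, w x ∂P) :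
    0 < m ∧ (∀ᵐ x ∂P, w x ^ (1 - p) ≤ m ^ (1 - p)) ∧
    Integrable (fun x => w x ^ t) P ∧ Integrable (fun x => w x ^ (1 - p)) P ∧
    ∫ x, w x ^ (1 - p) ∂P ≤ (C1 * C2) ^ (p - 1) * (∫ x, w x ^ t ∂P) ^ ((1 - p) / t) ∧
    m ^ (1 - p) ≤ (C1 * C2) ^ (p - 1) * ∫ x, w x ^ (1 - p) ∂P := by
  have hs0 : 0 < s := by linarith
  have hposint : ∀ f : α → ℝ, Integrable f P → (∀ᵐ x ∂P, 0 < f x) → 0 < ∫ x, f x ∂P := by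
    intro f hf hf0
    have hnn : 0 ≤ᵐ[P] f := hf0.mono fun x hx => hx.le
    rw [integral_pos_iff_support_of_nonneg_ae hnn hf]
    have : Function.support f =ᵐ[P] Set.univ := by
      rw [Filter.eventuallyEq_univ]
      filter_upwards [hf0] with x hx using hx.ne'
    rw [measure_congr this]; simp
  have ha := hposint w hi hpos
  have hm0 : 0 < m := by
    by_contra hcon
    push Not at hcon
    nlinarith
  have hle : ∀ᵐ x ∂P, w x ^ (1 - p) ≤ m ^ (1 - p) := by
    filter_upwards [hm] with x hx
    exact Real.rpow_le_rpow_of_nonpos hm0 hx (by linarith)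
  have hit : Integrable (fun x => w x ^ t) P := by
    refine Integrable.mono' ((integrable_const (1:ℝ)).add his) (hwm.pow_const t).aestronglyMeasurable ?_
    filter_upwards [hpos] with x hx
    have h0 := Real.rpow_nonneg hx.le t
    have h3 := Real.rpow_nonneg hx.le s
    rw [Real.norm_of_nonneg h0]
    simp only [Pi.add_apply]
    rcases le_total (w x) 1 with h | h
    · have := Real.rpow_le_one hx.le h ht.le
      linarith
    · have := Real.rpow_le_rpow_of_exponent_le h hts
      linarith
  have hiu : Integrable (fun x => w x ^ (1 - p)) P := by
    refine Integrable.mono' (integrable_const (m ^ (1 - p))) (hwm.pow_const _).aestronglyMeasurable ?_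
    filter_upwards [hpos, hle] with x hx hx2
    rwa [Real.norm_of_nonneg (Real.rpow_nonneg hx.le _)]
  refine ⟨hm0, hle, hit, hiu, ?_, ?_⟩
  · have hT := hposint _ hit (hpos.mono fun x hx => Real.rpow_pos_of_pos hx t)
    have hS := hposint _ his (hpos.mono fun x hx => Real.rpow_pos_of_pos hx s)
    have hJ : (∫ x, w x ^ t ∂P) ^ (s / t) ≤ ∫ x, w x ^ s ∂P := by
      have hst : 1 ≤ s / t := by rwa [le_div_iff₀ ht, one_mul]
      have heq : (fun x => (w x ^ t) ^ (s / t)) =ᵐ[P] fun x => w x ^ s := by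
        filter_upwards [hpos] with x hx
        rw [← Real.rpow_mul hx.le]
        congr 1; field_simp
      have := (convexOn_rpow hst).map_integral_le (μ := P) (f := fun x => w x ^ t)
        (Real.continuous_rpow_const (by linarith)).continuousOn isClosed_Ici
        (hpos.mono fun x hx => Real.rpow_nonneg hx.le t) hit (his.congr heq.symm)
      rwa [integral_congr_ae heq] at this
    have hK : (∫ x, w x ^ t ∂P) ^ (1 / t) ≤ C1 * C2 * m := by
      calc (∫ x, w x ^ t ∂P) ^ (1 / t) = ((∫ x, w x ^ t ∂P) ^ (s / t)) ^ (1 / s) := by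
            rw [← Real.rpow_mul hT.le]; congr 1; field_simp
        _ ≤ (∫ x, w x ^ s ∂P) ^ (1 / s) := by gcongr
        _ ≤ _ := h2
        _ ≤ C2 * (C1 * m) := by gcongr
        _ = _ := by ring
    have hL : (C1 * C2 * m) ^ (1 - p) ≤ (∫ x, w x ^ t ∂P) ^ ((1 - p) / t) := by
      have : (∫ x, w x ^ t ∂P) ^ ((1 - p) / t) = ((∫ x, w x ^ t ∂P) ^ (1 / t)) ^ (1 - p) := by
        rw [← Real.rpow_mul hT.le]; congr 1; ring
      rw [this]
      exact Real.rpow_le_rpow_of_nonpos (Real.rpow_pos_of_pos hT _) hK (by linarith)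
    have hM : ∫ x, w x ^ (1 - p) ∂P ≤ m ^ (1 - p) := by
      have := integral_mono_ae hiu (integrable_const _) hle
      simpa using this
    have hC : 0 < C1 * C2 := by positivity
    calc _ ≤ m ^ (1 - p) := hM
      _ = (C1 * C2) ^ (p - 1) * (C1 * C2 * m) ^ (1 - p) := by
        rw [Real.mul_rpow hC.le hm0.le, ← mul_assoc, ← Real.rpow_add hC]; simp
      _ ≤ _ := by gcongr
  · set a := ∫ x, w x ∂P with hadef
    have htan : ∀ᵐ x ∂P, a ^ (1 - p) * (1 - (p - 1) * (w x / a - 1)) ≤ w x ^ (1 - p) := by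
      filter_upwards [hpos] with x hx
      have hy : 0 < w x / a := by positivity
      have h3 : 1 - (p - 1) * (w x / a - 1) ≤ (w x / a) ^ (1 - p) := by
        rw [Real.rpow_def_of_pos hy]
        have h4 := Real.add_one_le_exp (Real.log (w x / a) * (1 - p))
        have h5 := Real.log_le_sub_one_of_pos hy
        nlinarith
      calc _ ≤ a ^ (1 - p) * (w x / a) ^ (1 - p) := by gcongr
        _ = _ := by rw [← Real.mul_rpow ha.le hy.le]; congr 1; field_simp
    have hint : Integrable (fun x => a ^ (1 - p) * (1 - (p - 1) * (w x / a - 1))) P :=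
      ((integrable_const _).sub (((hi.div_const a).sub (integrable_const _)).const_mul _)).const_mul _
    have hJ : a ^ (1 - p) ≤ ∫ x, w x ^ (1 - p) ∂P := by
      have h6 := integral_mono_ae hint hiu htan
      have h7 : ∫ x, a ^ (1 - p) * (1 - (p - 1) * (w x / a - 1)) ∂P = a ^ (1 - p) := by
        have hd : Integrable (fun x => w x / a - 1) P :=
          (hi.div_const a).sub (integrable_const _)
        rw [integral_const_mul, integral_sub (integrable_const _)
          (hd.const_mul _), integral_const_mul,
          integral_sub (hi.div_const a) (integrable_const _), integral_div, ← hadef, div_self ha.ne']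
        simp
      linarith
    have hC : 0 < C1 * C2 := by positivity
    calc m ^ (1 - p) = (C1 * C2) ^ (p - 1) * (C1 * C2 * m) ^ (1 - p) := by
          rw [Real.mul_rpow hC.le hm0.le, ← mul_assoc, ← Real.rpow_add hC]; simp
      _ ≤ (C1 * C2) ^ (p - 1) * a ^ (1 - p) := by
          gcongr ?_ * ?_
          refine Real.rpow_le_rpow_of_nonpos ha ?_ (by linarith)
          refine h1.trans ?_
          gcongr
          nlinarith
      _ ≤ _ := by gcongr

theorem memRC_RCconst {n : ℕ} {Ω : Set (EuclideanSpace ℝ (Fin n))}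
    {w : EuclideanSpace ℝ (Fin n) → ℝ} {r s : EReal} (h : InRC Ω w r s) :
    1 ≤ RCconst Ω w r s ∧ MemRC Ω w r s (RCconst Ω w r s) := by
  have hne : {C : ℝ | 1 ≤ C ∧ MemRC Ω w r s C}.Nonempty := h
  have hbdd : BddBelow {C : ℝ | 1 ≤ C ∧ MemRC Ω w r s C} := ⟨1, fun C hC => hC.1⟩
  have hcl : IsClosed {C : ℝ | 1 ≤ C ∧ MemRC Ω w r s C} := by
    have : {C : ℝ | 1 ≤ C ∧ MemRC Ω w r s C} = Set.Ici 1 ∩ ⋂ B ∈ ballsIn Ω,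
        {C | MeanFinite w r B ∧ MeanFinite w s B ∧ pMean w s B ≤ C * pMean w r B} := by
      ext C; simp [MemRC]
    rw [this]
    refine isClosed_Ici.inter (isClosed_biInter fun B _ => ?_)
    refine IsClosed.and isClosed_const (IsClosed.and isClosed_const ?_)
    exact isClosed_le continuous_const (by fun_prop)
  exact hcl.csInf_mem hne hbdd

theorem RCconst_le {n : ℕ} {Ω : Set (EuclideanSpace ℝ (Fin n))}
    {w : EuclideanSpace ℝ (Fin n) → ℝ} {r s : EReal} {C : ℝ} (h1 : 1 ≤ C) (h : MemRC Ω w r s C) :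
    RCconst Ω w r s ≤ C :=
  csInf_le ⟨1, fun _ hC => hC.1⟩ ⟨h1, h⟩

theorem ball_core {n : ℕ} 
    {Ω : Set (EuclideanSpace ℝ (Fin n))}
    {w : EuclideanSpace ℝ (Fin n) → ℝ} (hw : IsWeight Ω w)
    {s : ℝ} (hs : 1 < s) {C1 C2 : ℝ} (hC1 : 1 ≤ C1) (hC2 : 1 ≤ C2)
    (hA1 : MemRC Ω w ⊥ 1 C1) (hRHs : MemRC Ω w 1 ((s : ℝ) : EReal) C2)
    {p q : ℝ} (hp : 1 < p) (hq : (p - 1) / s + 1 < q) :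
    MemRC Ω (fun x => w x ^ (1 - p)) ((1 / (1 - q) : ℝ) : EReal) 1 ((C1 * C2) ^ (p - 1)) ∧
    MemRC Ω (fun x => w x ^ (1 - p)) 1 ⊤ ((C1 * C2) ^ (p - 1)) := by
  have hs0 : 0 < s := by linarith
  have hq1 : 1 < q := by
    have : 0 < (p - 1) / s := div_pos (by linarith) hs0
    linarith
  have hr0 : 1 / (1 - q) ≠ 0 := one_div_ne_zero (by linarith)
  have hsE : ((s : ℝ) : EReal) ≠ 0 := by exact_mod_cast hs0.ne'
  have hrE : ((1 / (1 - q) : ℝ) : EReal) ≠ 0 := by exact_mod_cast hr0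
  have h1T : (1 : EReal) ≠ ⊤ := EReal.coe_ne_top 1
  have h1B : (1 : EReal) ≠ ⊥ := EReal.coe_ne_bot 1
  unfold MemRC
  rw [← forall₂_and]
  intro B hB
  obtain ⟨-, hf1, hle1⟩ := hA1 B hB
  obtain ⟨-, hfs, hle2⟩ := hRHs B hB
  have hfb := (hA1 B hB).1
  obtain ⟨x, ρ, hρ, rfl, hsub⟩ := hB
  set B := Metric.ball x ρ with hBdef
  have hBΩ : B ⊆ Ω := (Metric.ball_subset_ball (by linarith)).trans hsub
  have hB0 : volume B ≠ 0 := (Metric.measure_ball_pos volume x hρ).ne'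
  have hBT : volume B ≠ ⊤ := measure_ball_lt_top.ne
  have hposB : ∀ᵐ y ∂(volume.restrict B), 0 < w y := by
    rw [ae_restrict_iff' measurableSet_ball]
    filter_upwards [hw.2] with y hy hyB using hy (hBΩ hyB)
  simp only [MeanFinite, pMean, h1T, h1B, hsE, hrE, EReal.coe_ne_top, EReal.coe_ne_bot,
    EReal.toReal_coe, EReal.toReal_one, one_ne_zero, if_false, if_true, Real.rpow_one,
    bot_ne_top, div_one] at hf1 hle1 hfs hle2 hfb ⊢
  set μ := volume.restrict B with hμ
  have hμ0 : μ ≠ 0 := by rwa [hμ, Ne, Measure.restrict_eq_zero]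
  haveI : NeZero μ := ⟨hμ0⟩
  haveI : IsFiniteMeasure μ := ⟨by simpa [hμ] using hBT.lt_top⟩
  set P := (μ Set.univ)⁻¹ • μ with hP
  have hPμ : ae P = ae μ := by
    refine Measure.ae_ennreal_smul_measure_eq ?_ _
    simp
  have hc0 : (μ Set.univ)⁻¹ ≠ 0 := by simp
  have hcT : (μ Set.univ)⁻¹ ≠ ⊤ := by simpa using hμ0
  have hint : ∀ f : EuclideanSpace ℝ (Fin n) → ℝ, Integrable f P ↔ IntegrableOn f B :=
    fun f => integrable_smul_measure hc0 hcT
  have hav : ∀ f : EuclideanSpace ℝ (Fin n) → ℝ, ⨍ y, f y ∂μ = ∫ y, f y ∂P := fun f => rfl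
  haveI : IsProbabilityMeasure P := inferInstance
  set m := essInf w μ with hmdef
  have hm : ∀ᵐ y ∂μ, m ≤ w y := ae_essInf_le hfb
  simp only [hav] at *
  have ht : 0 < (1 - p) * (1 / (1 - q)) := by
    have : (1 - p) * (1 / (1 - q)) = (p - 1) / (q - 1) := by
      rw [← neg_sub q 1, ← neg_sub p 1]; field_simp
    rw [this]; exact div_pos (by linarith) (by linarith)
  have hts : (1 - p) * (1 / (1 - q)) ≤ s := by
    have : (1 - p) * (1 / (1 - q)) = (p - 1) / (q - 1) := by
      rw [← neg_sub q 1, ← neg_sub p 1]; field_simp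
    rw [this, div_le_iff₀ (by linarith)]
    have h : (p - 1) / s < q - 1 := by linarith
    rw [div_lt_iff₀ hs0] at h
    linarith
  obtain ⟨hm0, hle, hit, hiu, hc1, hc2⟩ := core_prob P hw.1 (by rwa [hPμ]) (m := m) (by rwa [hPμ])
    hs hp ht hts hC1 hC2 ((hint _).2 hf1) ((hint _).2 hfs) hle1 hle2
  have heq : (fun y => (w y ^ (1 - p)) ^ (1 / (1 - q))) =ᵐ[P]
      fun y => w y ^ ((1 - p) * (1 / (1 - q))) := by
    rw [Filter.EventuallyEq, hPμ]
    filter_upwards [hposB] with y hy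
    rw [Real.rpow_mul hy.le]
  have hexp : (1 - p) / ((1 - p) * (1 / (1 - q))) = 1 / (1 / (1 - q)) := by
    have : 1 - p ≠ 0 := by linarith
    have : 1 - q ≠ 0 := by linarith
    field_simp
  rw [hexp] at hc1
  refine ⟨⟨(hint _).1 (hit.congr heq.symm), (hint _).1 hiu, ?_⟩, (hint _).1 hiu,
    ⟨m ^ (1 - p), by rwa [hPμ] at hle⟩, ?_⟩
  · rw [integral_congr_ae heq]; exact hc1
  · refine le_trans (essSup_le_of_ae_le _ (by rwa [hPμ] at hle) ?_) hc2
    refine Filter.IsBoundedUnder.isCoboundedUnder_le ⟨0, ?_⟩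
    rw [Filter.eventually_map]
    filter_upwards [hposB] with y hy using Real.rpow_nonneg hy.le _

/-- **Corollary 4.5.** For `1 < s < ∞`: if `w ∈ A₁ ∩ RH_s`, then for every `1 < p < ∞` and
every `q > (p−1)/s + 1` one has `w^{1−p} ∈ A_q ∩ RH_∞`, with
`max{[w^{1−p}]_{A_q}, [w^{1−p}]_{RH_∞}} ≤ ([w]_{A₁}·[w]_{RH_s})^{p−1}`. -/
theorem a1_rhs_to_aq_rhinf {n : ℕ} (hn : 1 ≤ n)
    {Ω : Set (EuclideanSpace ℝ (Fin n))} (hΩ : IsOpen Ω)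
    {w : EuclideanSpace ℝ (Fin n) → ℝ} (hw : IsWeight Ω w)
    {s : ℝ} (hs : 1 < s)
    (hA1 : InRC Ω w ⊥ 1) (hRHs : InRC Ω w 1 ((s : ℝ) : EReal)) :
    ∀ p : ℝ, 1 < p → ∀ q : ℝ, (p - 1) / s + 1 < q →
    InRC Ω (fun x => w x ^ (1 - p)) ((1 / (1 - q) : ℝ) : EReal) 1 ∧
    InRC Ω (fun x => w x ^ (1 - p)) 1 ⊤ ∧
    max (RCconst Ω (fun x => w x ^ (1 - p)) ((1 / (1 - q) : ℝ) : EReal) 1)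
        (RCconst Ω (fun x => w x ^ (1 - p)) 1 ⊤)
      ≤ (RCconst Ω w ⊥ 1 * RCconst Ω w 1 ((s : ℝ) : EReal)) ^ (p - 1) := by
  intro p hp q hq
  obtain ⟨hC1, hM1⟩ := memRC_RCconst hA1
  obtain ⟨hC2, hM2⟩ := memRC_RCconst hRHs
  obtain ⟨h1, h2⟩ := ball_core hw hs hC1 hC2 hM1 hM2 hp hq
  have hK : 1 ≤ (RCconst Ω w ⊥ 1 * RCconst Ω w 1 ((s : ℝ) : EReal)) ^ (p - 1) :=
    Real.one_le_rpow (one_le_mul_of_one_le_of_one_le hC1 hC2) (by linarith)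
  exact ⟨⟨_, hK, h1⟩, ⟨_, hK, h2⟩, max_le (RCconst_le hK h1) (RCconst_le hK h2)⟩
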